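/- Let R be a commutative ring and A a cochain complex of R-modules. If A is K-flat (i.e. A ⊗_R X is acyclic for every acyclic complex X), then for any quasi-isomorphism of complexes f : B → B', the induced map A ⊗_R B → A ⊗_R B' is a quasi-isomorphism, provided B and B' are also K-flat. -/

import Mathlib

open CategoryTheory Limits MonoidalCategory
set_option synthInstance.maxHeartbeats 1000000
set_option maxHeartbeats 1000000

namespace Stmt1

variable (R : Type) [CommRing R]

instance : (curriedTensor (ModuleCat R)).Additive where
  map_add := by
    intro X Y f g
    apply NatTrans.ext
    funext Z
    exact MonoidalPreadditive.add_whiskerRight f g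

noncomputable instance (X : ModuleCat R) :
    PreservesColimitsOfSize.{0, 0} ((curriedTensor (ModuleCat R)).obj X) := by
  have : PreservesColimitsOfSize.{0, 0} (tensorLeft X) := preservesColimitsOfSize_shrink _
  exact this

noncomputable instance (X : ModuleCat R) :
    PreservesColimitsOfSize.{0, 0} ((curriedTensor (ModuleCat R)).flip.obj X) := by
  have h : tensorLeft X ≅ tensorRight X :=
    NatIso.ofComponents (fun Y => β_ X Y) (by intros; simp)
  have h2 : PreservesColimitsOfSize.{0, 0} (tensorLeft X) := preservesColimitsOfSize_shrink _
  have : PreservesColimitsOfSize.{0, 0} (tensorRight X) := preservesColimits_of_natIso h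
  exact this

/-- A cochain complex of `R`-modules is acyclic if it is exact at every degree. -/
def Acyclic (K : CochainComplex (ModuleCat R) ℤ) : Prop :=
  ∀ i : ℤ, K.ExactAt i

/-- A cochain complex `A` of `R`-modules is K-flat if `A ⊗ X` is acyclic
for every acyclic complex `X`. -/
def KFlat (A : CochainComplex (ModuleCat R) ℤ) : Prop :=
  ∀ X : CochainComplex (ModuleCat R) ℤ, Acyclic R X → Acyclic R (A ⊗ X)

end Stmt1

namespace HomologicalComplex

section

variable {C₁ C₂ D I₁ I₂ J : Type*} [Category* C₁] [Category* C₂] [Category* D]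
  [Preadditive C₁] [Preadditive C₂] [Preadditive D]
  {c₁ : ComplexShape I₁} {c₂ : ComplexShape I₂}
  (K : HomologicalComplex C₁ c₁) {L M N : HomologicalComplex C₂ c₂}
  (F : C₁ ⥤ C₂ ⥤ D) [F.Additive] [∀ X₁, (F.obj X₁).Additive]
  (c : ComplexShape J) [DecidableEq J] [TotalComplexShape c₁ c₂ c]
  [HasMapBifunctor K L F c] [HasMapBifunctor K M F c] [HasMapBifunctor K N F c]

/-- The morphism in degree `j` between the total complexes `mapBifunctor K L F c` and
`mapBifunctor K M F c` that is induced by a morphism of graded objects `L.X ⟶ M.X`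
(not necessarily compatible with the differentials). -/
noncomputable def mapBifunctorGradedMap (φ : ∀ i, L.X i ⟶ M.X i) (j : J) :
    (mapBifunctor K L F c).X j ⟶ (mapBifunctor K M F c).X j :=
  mapBifunctorDesc (fun i₁ i₂ h => (F.obj (K.X i₁)).map (φ i₂) ≫ ιMapBifunctor K M F c i₁ i₂ j h)

@[simp]
lemma ι_mapBifunctorGradedMap (φ : ∀ i, L.X i ⟶ M.X i) (i₁ : I₁) (i₂ : I₂) (j : J)
    (h : ComplexShape.π c₁ c₂ c (i₁, i₂) = j) :
    ιMapBifunctor K L F c i₁ i₂ j h ≫ mapBifunctorGradedMap K F c φ j =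
      (F.obj (K.X i₁)).map (φ i₂) ≫ ιMapBifunctor K M F c i₁ i₂ j h :=
  ι_mapBifunctorDesc _ _ _ _

lemma mapBifunctorMap_f_eq_mapBifunctorGradedMap (f : L ⟶ M) (j : J) :
    (mapBifunctorMap (𝟙 K) f F c).f j = mapBifunctorGradedMap K F c f.f j := by
  apply mapBifunctor.hom_ext
  intro i₁ i₂ h
  rw [ι_mapBifunctorMap, ι_mapBifunctorGradedMap]
  simp

lemma mapBifunctorGradedMap_id (j : J) :
    mapBifunctorGradedMap K F c (fun i => 𝟙 (L.X i)) j = 𝟙 _ := by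
  apply mapBifunctor.hom_ext
  intro i₁ i₂ h
  rw [ι_mapBifunctorGradedMap]
  simp

lemma mapBifunctorGradedMap_zero (j : J) :
    mapBifunctorGradedMap K F c (fun i => (0 : L.X i ⟶ M.X i)) j = 0 := by
  apply mapBifunctor.hom_ext
  intro i₁ i₂ h
  rw [ι_mapBifunctorGradedMap]
  simp

lemma mapBifunctorGradedMap_add (φ ψ : ∀ i, L.X i ⟶ M.X i) (j : J) :
    mapBifunctorGradedMap K F c (fun i => φ i + ψ i) j =
      mapBifunctorGradedMap K F c φ j + mapBifunctorGradedMap K F c ψ j := by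
  apply mapBifunctor.hom_ext
  intro i₁ i₂ h
  rw [Preadditive.comp_add]
  simp only [ι_mapBifunctorGradedMap, Functor.map_add, Preadditive.add_comp]

lemma mapBifunctorGradedMap_comp (φ : ∀ i, L.X i ⟶ M.X i) (ψ : ∀ i, M.X i ⟶ N.X i) (j : J) :
    mapBifunctorGradedMap K F c φ j ≫ mapBifunctorGradedMap K F c ψ j =
      mapBifunctorGradedMap K F c (fun i => φ i ≫ ψ i) j := by
  apply mapBifunctor.hom_ext
  intro i₁ i₂ h
  rw [← Category.assoc]
  simp only [ι_mapBifunctorGradedMap, Functor.map_comp, Category.assoc]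

end

section

variable {C₁ C₂ D I₁ I₂ J : Type*} [Category* C₁] [Category* C₂] [Category* D]
  [Preadditive C₁] [Preadditive C₂] [Preadditive D]
  {c₁ : ComplexShape I₁} {c₂ : ComplexShape I₂}
  (K : HomologicalComplex C₁ c₁) (S : ShortComplex (HomologicalComplex C₂ c₂))
  (F : C₁ ⥤ C₂ ⥤ D) [F.Additive] [∀ X₁, (F.obj X₁).Additive]
  (c : ComplexShape J) [DecidableEq J] [TotalComplexShape c₁ c₂ c]
  [HasMapBifunctor K S.X₁ F c] [HasMapBifunctor K S.X₂ F c] [HasMapBifunctor K S.X₃ F c]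

/-- The short complex obtained by applying a bifunctor, with a fixed first argument,
to a short complex of homological complexes. -/
@[simps]
noncomputable def mapBifunctorShortComplex : ShortComplex (HomologicalComplex D c) where
  X₁ := mapBifunctor K S.X₁ F c
  X₂ := mapBifunctor K S.X₂ F c
  X₃ := mapBifunctor K S.X₃ F c
  f := mapBifunctorMap (𝟙 K) S.f F c
  g := mapBifunctorMap (𝟙 K) S.g F c
  zero := by
    ext1 j
    rw [comp_f, mapBifunctorMap_f_eq_mapBifunctorGradedMap,
      mapBifunctorMap_f_eq_mapBifunctorGradedMap, mapBifunctorGradedMap_comp]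
    simp only [← comp_f, S.zero]
    exact mapBifunctorGradedMap_zero K F c j

/-- Applying a bifunctor preserves degreewise split short complexes. -/
noncomputable def mapBifunctorShortComplexSplitting
    (σ : ∀ i, (S.map (eval C₂ c₂ i)).Splitting) (j : J) :
    ((mapBifunctorShortComplex K S F c).map (eval D c j)).Splitting where
  r := mapBifunctorGradedMap K F c (L := S.X₂) (M := S.X₁) (fun i => (σ i).r) j
  s := mapBifunctorGradedMap K F c (L := S.X₃) (M := S.X₂) (fun i => (σ i).s) j
  f_r := by
    refine Eq.trans ?_ (mapBifunctorGradedMap_id K F c j)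
    refine (congrArg (· ≫ _) (mapBifunctorMap_f_eq_mapBifunctorGradedMap K F c S.f j)).trans ?_
    refine (mapBifunctorGradedMap_comp K F c _ _ j).trans ?_
    congr 1
    funext i
    exact (σ i).f_r
  s_g := by
    refine Eq.trans ?_ (mapBifunctorGradedMap_id K F c j)
    refine (congrArg (_ ≫ ·) (mapBifunctorMap_f_eq_mapBifunctorGradedMap K F c S.g j)).trans ?_
    refine (mapBifunctorGradedMap_comp K F c _ _ j).trans ?_
    congr 1
    funext i
    exact (σ i).s_g
  id := by
    refine Eq.trans ?_ (mapBifunctorGradedMap_id K F c j)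
    refine (congrArg₂ (fun a b => _ ≫ a + b ≫ _)
      (mapBifunctorMap_f_eq_mapBifunctorGradedMap K F c S.f j)
      (mapBifunctorMap_f_eq_mapBifunctorGradedMap K F c S.g j)).trans ?_
    refine (congrArg₂ (· + ·) (mapBifunctorGradedMap_comp K F c _ _ j)
      (mapBifunctorGradedMap_comp K F c _ _ j)).trans ?_
    refine (mapBifunctorGradedMap_add K F c _ _ j).symm.trans ?_
    congr 1
    funext i
    exact (σ i).id

end

section

variable {C ι : Type*} [Category* C] [Abelian C] {c : ComplexShape ι}
  {S : ShortComplex (HomologicalComplex C c)}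

lemma shortExact_of_degreewise_splitting (σ : ∀ i, (S.map (eval C c i)).Splitting) :
    S.ShortExact :=
  shortExact_of_degreewise_shortExact S (fun i => (σ i).shortExact)

end

end HomologicalComplex

namespace CategoryTheory.ShortComplex.ShortExact

variable {C ι : Type*} [Category* C] [Abelian C] {c : ComplexShape ι}
  {S : ShortComplex (HomologicalComplex C c)}

lemma quasiIso_f (hS : S.ShortExact) (h₃ : S.X₃.Acyclic) : _root_.QuasiIso S.f where
  quasiIsoAt i := by
    rw [quasiIsoAt_iff_isIso_homologyMap]
    have hX (j : ι) := (S.X₃.exactAt_iff_isZero_homology j).1 (h₃ j)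
    have : Epi (HomologicalComplex.homologyMap S.f i) :=
      (hS.homology_exact₂ i).epi_f ((hX i).eq_of_tgt _ _)
    have : Mono (HomologicalComplex.homologyMap S.f i) := by
      by_cases! hi : ∃ k, c.Rel k i
      · obtain ⟨k, hk⟩ := hi
        exact (hS.homology_exact₁ k i hk).mono_g ((hX k).eq_of_src _ _)
      · have := hS.mono_f
        exact HomologicalComplex.mono_homologyMap_of_mono_of_not_rel S.f i hi
    exact isIso_of_mono_of_epi _

lemma quasiIso_g (hS : S.ShortExact) (h₁ : S.X₁.Acyclic) : _root_.QuasiIso S.g where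
  quasiIsoAt i := by
    rw [quasiIsoAt_iff_isIso_homologyMap]
    have hX (j : ι) := (S.X₁.exactAt_iff_isZero_homology j).1 (h₁ j)
    have : Mono (HomologicalComplex.homologyMap S.g i) :=
      (hS.homology_exact₂ i).mono_g ((hX i).eq_of_src _ _)
    have : Epi (HomologicalComplex.homologyMap S.g i) := by
      by_cases! hi : ∃ k, c.Rel i k
      · obtain ⟨k, hk⟩ := hi
        exact (hS.homology_exact₃ i k hk).epi_f ((hX k).eq_of_tgt _ _)
      · have := hS.epi_g
        exact HomologicalComplex.epi_homologyMap_of_epi_of_not_rel S.g i hi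
    exact isIso_of_mono_of_epi _

end CategoryTheory.ShortComplex.ShortExact

namespace CochainComplex

variable {C : Type*} [Category* C] [Abelian C]

lemma acyclic_mappingCone_id (K : CochainComplex C ℤ) : (mappingCone (𝟙 K)).Acyclic := by
  intro i
  rw [HomologicalComplex.exactAt_iff_isZero_homology, IsZero.iff_id_eq_zero,
    ← HomologicalComplex.homologyMap_id,
    (mappingCone.homotopyToZeroOfId K).homologyMap_eq i, HomologicalComplex.homologyMap_zero]

variable {K L : CochainComplex C ℤ} (f : K ⟶ L)

/-- The degreewise split monomorphism `K ⟶ L ⊞ mappingCone (𝟙 K)` lifting `f : K ⟶ L`. -/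
noncomputable abbrev cylinderι : K ⟶ L ⊞ mappingCone (𝟙 K) :=
  biprod.lift f (mappingCone.inr (𝟙 K))

/-- The degreewise split short complex `K ⟶ L ⊞ mappingCone (𝟙 K) ⟶ cokernel (cylinderι f)`. -/
@[simps]
noncomputable def cylinderShortComplex : ShortComplex (CochainComplex C ℤ) where
  f := cylinderι f
  g := cokernel.π (cylinderι f)
  zero := cokernel.condition _

/-- The degreewise splitting of `cylinderShortComplex f`. -/
noncomputable def cylinderShortComplexSplitting (i : ℤ) :
    ((cylinderShortComplex f).map (HomologicalComplex.eval C _ i)).Splitting :=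
  .ofExactOfRetraction _
    (((cylinderShortComplex f).exact_of_g_is_cokernel (cokernelIsCokernel _)).map
      (HomologicalComplex.eval C _ i))
    ((biprod.snd : L ⊞ mappingCone (𝟙 K) ⟶ _).f i ≫ (mappingCone.snd (𝟙 K)).v i i (add_zero i))
    (by
      change (cylinderι f).f i ≫ _ ≫ _ = 𝟙 _
      rw [← HomologicalComplex.comp_f_assoc, biprod.lift_snd, mappingCone.inr_f_snd_v])
    (by
      have : Epi (cylinderShortComplex f).g :=
        inferInstanceAs (Epi (cokernel.π (cylinderι f)))
      exact inferInstanceAs (Epi ((cylinderShortComplex f).g.f i)))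

variable (K L) in
/-- The split short complex `mappingCone (𝟙 K) ⟶ L ⊞ mappingCone (𝟙 K) ⟶ L`. -/
@[simps]
noncomputable def cylinderProjShortComplex : ShortComplex (CochainComplex C ℤ) where
  f := (biprod.inr : mappingCone (𝟙 K) ⟶ L ⊞ mappingCone (𝟙 K))
  g := biprod.fst
  zero := by simp

variable (K L) in
/-- The splitting of `cylinderProjShortComplex K L`. -/
noncomputable def cylinderProjShortComplexSplitting :
    (cylinderProjShortComplex K L).Splitting where
  r := biprod.snd
  s := biprod.inl
  f_r := biprod.inr_snd
  s_g := biprod.inl_fst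
  id := (add_comm _ _).trans biprod.total

instance : QuasiIso (biprod.fst : L ⊞ mappingCone (𝟙 K) ⟶ L) :=
  (cylinderProjShortComplexSplitting K L).shortExact.quasiIso_g (acyclic_mappingCone_id K)

lemma acyclic_cylinderShortComplex_X₃ [QuasiIso f] :
    (cylinderShortComplex f).X₃.Acyclic := by
  refine (HomologicalComplex.shortExact_of_degreewise_splitting
    (cylinderShortComplexSplitting f)).acyclic_X₃ ?_
  have : QuasiIso (cylinderι f ≫ biprod.fst) := by
    rwa [biprod.lift_fst]
  exact quasiIso_of_comp_right (cylinderι f) biprod.fst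

end CochainComplex

namespace Stmt1

variable (R : Type) [CommRing R]

lemma shortExact_tensor (A : CochainComplex (ModuleCat R) ℤ)
    (S : ShortComplex (CochainComplex (ModuleCat R) ℤ))
    (σ : ∀ i, (S.map (HomologicalComplex.eval _ _ i)).Splitting) :
    (HomologicalComplex.mapBifunctorShortComplex A S (curriedTensor (ModuleCat R))
      (ComplexShape.up ℤ)).ShortExact :=
  HomologicalComplex.shortExact_of_degreewise_splitting
    (HomologicalComplex.mapBifunctorShortComplexSplitting A S _ _ σ)

variable {R} in
lemma KFlat.quasiIso_whiskerLeft {A : CochainComplex (ModuleCat R) ℤ} (hA : KFlat R A)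
    {B B' : CochainComplex (ModuleCat R) ℤ} (f : B ⟶ B') [QuasiIso f] :
    QuasiIso (A ◁ f) := by
  have : QuasiIso (A ◁ CochainComplex.cylinderι f) :=
    (shortExact_tensor R A _ (CochainComplex.cylinderShortComplexSplitting f)).quasiIso_f
      (hA _ (CochainComplex.acyclic_cylinderShortComplex_X₃ f))
  have : QuasiIso (A ◁ (biprod.fst : B' ⊞ CochainComplex.mappingCone (𝟙 B) ⟶ B')) :=
    (shortExact_tensor R A _ (fun i =>
      (CochainComplex.cylinderProjShortComplexSplitting B B').map _)).quasiIso_g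
      (hA _ (CochainComplex.acyclic_mappingCone_id B))
  rw [← biprod.lift_fst f (CochainComplex.mappingCone.inr (𝟙 B)),
    MonoidalCategory.whiskerLeft_comp]
  infer_instance

/-- If `A` is a K-flat cochain complex of `R`-modules, then for any
quasi-isomorphism `f : B ⟶ B'` between K-flat complexes, the induced map
`A ⊗ B ⟶ A ⊗ B'` is a quasi-isomorphism. -/
theorem kflat_tensor_quasiIso (A B B' : CochainComplex (ModuleCat R) ℤ)
    (hA : KFlat R A) (hB : KFlat R B) (hB' : KFlat R B')
    (f : B ⟶ B') (hf : QuasiIso f) :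
    QuasiIso (A ◁ f) := by
  exact hA.quasiIso_whiskerLeft f

end Stmt1
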